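/- Let n ≥ 1 and ψ: ℕ → ℝ⁺ be non-increasing with ψ(s) = o(s^{−(n+1)/n}). Then the set Bad(ψ) = W(ψ) \ ⋂_{c>0} W(cψ) of ψ-badly approximable points satisfies dim_H Bad(ψ) = dim_H W(ψ). -/

import Mathlib

open Real Filter MeasureTheory

/-- The set `W(ψ)` of `ψ`-approximable points of `ℝⁿ` (sup norm): those `x` admitting
infinitely many rational points `v = p/q ∈ ℚⁿ` with `‖x - p/q‖ < ψ(q)`, where `q` is the
reduced common denominator of `v`. -/
def Wapprox (n : ℕ) (ψ : ℕ → ℝ) : Set (Fin n → ℝ) :=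
  {x | {v : Fin n → ℚ |
      ‖x - fun i => (v i : ℝ)‖ < ψ (Finset.univ.lcm fun i => (v i).den)}.Infinite}

/-- The set `E(ψ) = W(ψ) \ ⋃_{0<c<1} W(cψ)` of exactly `ψ`-approximable points. -/
def Eapprox (n : ℕ) (ψ : ℕ → ℝ) : Set (Fin n → ℝ) :=
  Wapprox n ψ \ ⋃ c ∈ Set.Ioo (0 : ℝ) 1, Wapprox n (fun q => c * ψ q)

open scoped NNReal ENNReal

theorem one_le_dimH_range_ofDigits {P : ℕ} (hP : 2 ≤ P) :
    1 ≤ dimH (Set.range (Real.ofDigits : (ℕ → Fin P) → ℝ)) := by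
  have : NeZero P := ⟨by omega⟩
  have hsub : Set.Ico (0 : ℝ) 1 ⊆ Set.range (Real.ofDigits : (ℕ → Fin P) → ℝ) := fun x hx =>
    ⟨Real.digits x P, Real.ofDigits_digits (by omega) hx⟩
  have h := Real.dimH_of_nonempty_interior (E := ℝ) (s := Set.Ico (0 : ℝ) 1) (by simp)
  rw [Module.finrank_self, Nat.cast_one] at h
  exact h.symm.le.trans (dimH_mono hsub)

theorem le_dimH_range_of_separated {X : Type*} [MetricSpace X] {P : ℕ} (hP : 2 ≤ P)
    (pt : (ℕ → Fin P) → X) (δ : ℕ → ℝ) (hδ : ∀ i, 0 < δ i)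
    (hsep : ∀ a b i, (∀ j < i, a j = b j) → a i ≠ b i → δ i ≤ dist (pt a) (pt b))
    {s : ℝ≥0} (hs : 0 < s) {C : ℝ} (hC : ∀ i, ((P : ℝ) ^ i)⁻¹ ≤ C * δ i ^ (s : ℝ)) :
    (s : ℝ≥0∞) ≤ dimH (Set.range pt) := by
  classical
  have hfirst : ∀ a b : ℕ → Fin P, a ≠ b → ∃ i, (∀ j < i, a j = b j) ∧ a i ≠ b i := by
    intro a b hab
    have hex : ∃ i, a i ≠ b i := Function.ne_iff.mp hab
    exact ⟨Nat.find hex, fun j hj => not_not.mp (Nat.find_min hex hj), Nat.find_spec hex⟩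
  have hinj : Function.Injective pt := by
    intro a b hab
    by_contra hne
    obtain ⟨i, h1, h2⟩ := hfirst a b hne
    have := hsep a b i h1 h2
    rw [hab, dist_self] at this
    exact (hδ i).not_ge this
  have hC0 : 0 ≤ C := by
    have h := hC 0
    have h2 := Real.rpow_pos_of_pos (hδ 0) s
    by_contra hneg
    push Not at hneg
    have : C * δ 0 ^ (s : ℝ) < 0 := mul_neg_of_neg_of_pos hneg h2
    norm_num at h
    linarith
  let f : X → ℝ := Function.extend pt Real.ofDigits 0
  have hf : ∀ a, f (pt a) = Real.ofDigits a := fun a => hinj.extend_apply _ _ _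
  have hholder : HolderOnWith C.toNNReal s f (Set.range pt) := by
    rintro _ ⟨a, rfl⟩ _ ⟨b, rfl⟩
    rw [hf, hf]
    by_cases hab : a = b
    · simp [hab]
    obtain ⟨i, h1, h2⟩ := hfirst a b hab
    have hd : dist (Real.ofDigits a) (Real.ofDigits b) ≤ C * dist (pt a) (pt b) ^ (s : ℝ) := by
      rw [Real.dist_eq]
      refine (Real.abs_ofDigits_sub_ofDigits_le h1).trans ((hC i).trans ?_)
      gcongr
      · exact (hδ i).le
      · exact hsep a b i h1 h2
    rw [edist_dist, edist_dist, ENNReal.ofReal_rpow_of_nonneg dist_nonneg s.coe_nonneg]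
    change _ ≤ ENNReal.ofReal C * _
    rw [← ENNReal.ofReal_mul hC0]
    exact ENNReal.ofReal_le_ofReal hd
  have himg : f '' Set.range pt = Set.range (Real.ofDigits : (ℕ → Fin P) → ℝ) := by
    rw [← Set.range_comp]
    exact congrArg Set.range (funext hf)
  have hle := (one_le_dimH_range_ofDigits hP).trans (himg ▸ hholder.dimH_image_le hs)
  rw [ENNReal.le_div_iff_mul_le (by simp [hs.ne']) (by simp), one_mul] at hle
  exact hle

theorem le_dimH_iInter_of_separated_children {X : Type*} [MetricSpace X] [ProperSpace X] {P : ℕ}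
    (hP : 2 ≤ P) (r : ℕ → ℝ) (hr : ∀ i, 0 < r i) (cond : ℕ → Set X) (x₀ : X)
    (hstep : ∀ i x, Metric.closedBall x (r i) ⊆ ⋂ m < i, cond m →
      ∃ g : Fin P → X,
        (∀ k, Metric.closedBall (g k) (r (i + 1)) ⊆ Metric.closedBall x (r i) ∩ cond i) ∧
        ∀ k l, k ≠ l → 4 * r (i + 1) ≤ dist (g k) (g l))
    {s : ℝ≥0} (hs : 0 < s) {C : ℝ} (hC : ∀ i, ((P : ℝ) ^ i)⁻¹ ≤ C * r (i + 1) ^ (s : ℝ)) :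
    (s : ℝ≥0∞) ≤ dimH (⋂ i, cond i) := by
  choose! g hg hsep using hstep
  let c : ℕ → (ℕ → Fin P) → X := fun i a => Nat.rec x₀ (fun i x => g i x (a i)) i
  have hc : ∀ i a, c (i + 1) a = g i (c i a) (a i) := fun i a => rfl
  have hgood : ∀ i a, Metric.closedBall (c i a) (r i) ⊆ ⋂ m < i, cond m := by
    intro i a
    induction i with
    | zero => simp
    | succ i ih =>
      have h := hg i _ ih (a i)
      rw [← hc] at h
      intro y hy
      simp only [Set.mem_iInter]
      intro m hm
      rcases Nat.lt_succ_iff_lt_or_eq.mp hm with hm | rfl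
      · exact Set.mem_iInter₂.mp (ih (h hy).1) m hm
      · exact (h hy).2
  have hnest : ∀ i a, Metric.closedBall (c (i + 1) a) (r (i + 1)) ⊆
      Metric.closedBall (c i a) (r i) := fun i a y hy => (hg i _ (hgood i a) (a i) hy).1
  have hex : ∀ a, ∃ x, ∀ i, x ∈ Metric.closedBall (c i a) (r i) := by
    intro a
    have h := IsCompact.nonempty_iInter_of_sequence_nonempty_isCompact_isClosed
      (fun i => Metric.closedBall (c i a) (r i)) (fun i => hnest i a)
      (fun i => ⟨c i a, Metric.mem_closedBall_self (hr i).le⟩)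
      (isCompact_closedBall _ _) (fun i => Metric.isClosed_closedBall)
    obtain ⟨x, hx⟩ := h
    exact ⟨x, fun i => Set.mem_iInter.mp hx i⟩
  choose pt hpt using hex
  have hcongr : ∀ a b i, (∀ j < i, a j = b j) → c i a = c i b := by
    intro a b i h
    induction i with
    | zero => rfl
    | succ i ih =>
      rw [hc, hc, ih fun j hj => h j (by omega), h i (by omega)]
  have hsub : Set.range pt ⊆ ⋂ i, cond i := by
    rintro _ ⟨a, rfl⟩
    refine Set.mem_iInter.mpr fun m => ?_
    exact Set.mem_iInter₂.mp (hgood (m + 1) a (hpt a (m + 1))) m (Nat.lt_succ_self m)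
  refine le_trans ?_ (dimH_mono hsub)
  refine le_dimH_range_of_separated hP pt (fun i => r (i + 1)) (fun i => hr _) ?_ hs hC
  intro a b i h1 h2
  have h3 := hsep i (c i a) (hgood i a) (a i) (b i) h2
  have ha := Metric.mem_closedBall.mp (hpt a (i + 1))
  have hb := Metric.mem_closedBall.mp (hpt b (i + 1))
  rw [hc] at ha
  rw [hc, ← hcongr a b i h1] at hb
  have h4 := dist_triangle4 (g i (c i a) (a i)) (pt a) (pt b) (g i (c i a) (b i))
  rw [dist_comm] at ha
  have := hr (i + 1)
  linarith

/-- The reduced common denominator of a rational point. -/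
abbrev commonDen {n : ℕ} (v : Fin n → ℚ) : ℕ := Finset.univ.lcm fun i => (v i).den

theorem commonDen_pos {n : ℕ} (v : Fin n → ℚ) : 0 < commonDen v := by
  refine Nat.pos_of_ne_zero fun h => ?_
  rw [Finset.lcm_eq_zero_iff] at h
  obtain ⟨i, -, hi⟩ := h
  exact (v i).den_ne_zero hi

theorem exists_intCast_eq_mul_commonDen {n : ℕ} (v : Fin n → ℚ) (i : Fin n) :
    ∃ p : ℤ, (p : ℝ) = v i * commonDen v := by
  obtain ⟨k, hk⟩ : (v i).den ∣ commonDen v := Finset.dvd_lcm (Finset.mem_univ i)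
  refine ⟨(v i).num * k, ?_⟩
  rw [hk]
  have : ((v i).num : ℝ) = v i * (v i).den := by
    exact_mod_cast (Rat.mul_den_eq_num (v i)).symm
  push_cast
  rw [this]
  ring

/-- The homogeneous coordinates `(1, v)` of a point `v`. -/
def homCoord {n : ℕ} (v : Fin n → ℚ) : Unit ⊕ Fin n → ℝ :=
  Sum.elim (fun _ => 1) fun i => (v i : ℝ)

theorem one_le_prod_commonDen_mul_abs_det {n : ℕ} (v : Unit ⊕ Fin n → Fin n → ℚ)
    (h : (Matrix.of fun i => homCoord (v i)).det ≠ 0) :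
    1 ≤ (∏ i, (commonDen (v i) : ℝ)) * |(Matrix.of fun i => homCoord (v i)).det| := by
  choose p hp using fun i => exists_intCast_eq_mul_commonDen (v i)
  let A : Matrix (Unit ⊕ Fin n) (Unit ⊕ Fin n) ℤ :=
    Matrix.of fun i => Sum.elim (fun _ => (commonDen (v i) : ℤ)) (p i)
  have hA : (A.det : ℝ) = (∏ i, (commonDen (v i) : ℝ)) *
      (Matrix.of fun i => homCoord (v i)).det := by
    rw [← Matrix.det_mul_column, Int.cast_det]
    congr 1
    ext i j
    rcases j with j | j
    · simp [A, homCoord]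
    · simp [A, homCoord, hp, mul_comm]
  have hprod : 0 < ∏ i, (commonDen (v i) : ℝ) :=
    Finset.prod_pos fun i _ => by exact_mod_cast commonDen_pos (v i)
  have hne : A.det ≠ 0 := by
    intro h0
    rw [h0, Int.cast_zero] at hA
    exact mul_ne_zero hprod.ne' h hA.symm
  rw [← abs_of_pos hprod, ← abs_mul, ← hA, ← Int.cast_abs]
  exact_mod_cast Int.one_le_abs hne

theorem abs_det_homCoord_le {n : ℕ} (x : Fin n → ℝ) {ρ : ℝ} (hρ : 0 < ρ)
    (v : Unit ⊕ Fin n → Fin n → ℚ) (hv : ∀ i, ‖x - fun j => (v i j : ℝ)‖ ≤ ρ) :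
    |(Matrix.of fun i => homCoord (v i)).det| ≤ (n + 1).factorial * ρ ^ n := by
  let B : Matrix (Unit ⊕ Fin n) (Unit ⊕ Fin n) ℝ :=
    Matrix.of fun i => Sum.elim (fun _ => 1) fun j => (v i j - x j) / ρ
  let D : Matrix (Unit ⊕ Fin n) (Unit ⊕ Fin n) ℝ :=
    Matrix.fromBlocks 1 (Matrix.of fun _ j => x j) 0 (ρ • 1)
  have hBD : (Matrix.of fun i => homCoord (v i)) = B * D := by
    ext i j
    rw [Matrix.mul_apply, Fintype.sum_sum_type]
    rcases j with j | j
    · simp [B, D, homCoord]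
    · simp only [Matrix.of_apply, homCoord, Sum.elim_inr, B, D, Finset.univ_unique,
        Matrix.fromBlocks_apply₁₂, Matrix.fromBlocks_apply₂₂, Sum.elim_inl, Finset.sum_singleton,
        Matrix.smul_apply, Matrix.one_apply, smul_eq_mul, mul_ite, mul_one, mul_zero,
        Finset.sum_ite_eq', Finset.mem_univ, if_true]
      field_simp
      ring
  have hD : D.det = ρ ^ n := by
    simp [D, Matrix.det_fromBlocks_zero₂₁]
  have hB : |B.det| ≤ (n + 1).factorial := by
    have h := Matrix.det_le (A := B) (abv := AbsoluteValue.abs) (x := (1 : ℝ)) ?_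
    · simpa [add_comm] using h
    · rintro i (j | j)
      · simp [B]
      · simp only [B, Matrix.of_apply, Sum.elim_inr, AbsoluteValue.abs_apply, abs_div,
          abs_of_pos hρ]
        rw [div_le_one hρ, abs_sub_comm]
        exact (norm_le_pi_norm (x - fun j => (v i j : ℝ)) j).trans (hv i)
  rw [hBD, Matrix.det_mul, hD, abs_mul, abs_of_pos (pow_pos hρ n)]
  gcongr

theorem exists_hyperplane {n : ℕ} (hn : 1 ≤ n) (x : Fin n → ℝ) {ρ T : ℝ} (hρ : 0 < ρ)
    (hT : 0 ≤ T) (hTρ : T ^ (n + 1) * ((n + 1).factorial * ρ ^ n) < 1) :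
    ∃ (w : Fin n → ℝ) (b : ℝ), w ≠ 0 ∧ ∀ v : Fin n → ℚ,
      ‖x - fun i => (v i : ℝ)‖ ≤ ρ → (commonDen v : ℝ) ≤ T → ∑ i, w i * v i = b := by
  classical
  set V : Set (Fin n → ℚ) := {v | ‖x - fun i => (v i : ℝ)‖ ≤ ρ ∧ (commonDen v : ℝ) ≤ T} with hV
  by_cases hVe : V = ∅
  · refine ⟨fun _ => 1, 0, ?_, fun v h1 h2 => ?_⟩
    · intro h
      exact one_ne_zero (congrFun h ⟨0, hn⟩)
    · exact absurd (show v ∈ V from ⟨h1, h2⟩) (hVe ▸ Set.notMem_empty v)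
  obtain ⟨v₀, hv₀⟩ := Set.nonempty_iff_ne_empty.mpr hVe
  have hspan : Submodule.span ℝ (homCoord '' V) ≠ ⊤ := by
    intro htop
    obtain ⟨f, hf, -, hli⟩ := Submodule.exists_fun_fin_finrank_span_eq ℝ (homCoord '' V)
    have hcard : Fintype.card (Fin (Module.finrank ℝ (Submodule.span ℝ (homCoord '' V)))) =
        Fintype.card (Unit ⊕ Fin n) := by
      rw [htop]; simp [finrank_top]
    let e := Fintype.equivOfCardEq hcard
    choose v hv hvf using fun i => hf (e.symm i)
    have hli' : LinearIndependent ℝ (fun i => homCoord (v i)) := by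
      have : (fun i => homCoord (v i)) = f ∘ e.symm := funext hvf
      rw [this]
      exact hli.comp _ e.symm.injective
    have hunit := Matrix.linearIndependent_rows_iff_isUnit
      (A := Matrix.of fun i => homCoord (v i)) |>.mp hli'
    rw [Matrix.isUnit_iff_isUnit_det] at hunit
    have h1 := one_le_prod_commonDen_mul_abs_det v hunit.ne_zero
    have h2 := abs_det_homCoord_le x hρ v fun i => (hv i).1
    have h3 : ∏ i, (commonDen (v i) : ℝ) ≤ T ^ (n + 1) := by
      refine (Finset.prod_le_prod (fun i _ => by positivity) fun i _ => (hv i).2).trans ?_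
      simp [add_comm]
    have h4 : (∏ i, (commonDen (v i) : ℝ)) * |(Matrix.of fun i => homCoord (v i)).det| ≤
        T ^ (n + 1) * ((n + 1).factorial * ρ ^ n) := by gcongr
    linarith
  obtain ⟨φ, hφ, hker⟩ := Submodule.exists_le_ker_of_lt_top _ (lt_top_iff_ne_top.mpr hspan)
  have hsum : ∀ u : Unit ⊕ Fin n → ℝ, φ u =
      u (Sum.inl ()) * φ (Pi.single (Sum.inl ()) 1) +
        ∑ i, u (Sum.inr i) * φ (Pi.single (Sum.inr i) 1) := by
    intro u
    conv_lhs => rw [LinearMap.pi_apply_eq_sum_univ φ u]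
    rw [Fintype.sum_sum_type]
    simp only [Finset.univ_unique, Finset.sum_singleton, smul_eq_mul]
    congr! 6 <;> simp [Pi.single_apply, eq_comm]
  have hzero : ∀ v ∈ V, φ (Pi.single (Sum.inl ()) 1) +
      ∑ i, φ (Pi.single (Sum.inr i) 1) * v i = 0 := by
    intro v hv
    have h := hker (Submodule.subset_span ⟨v, hv, rfl⟩)
    rw [LinearMap.mem_ker, hsum] at h
    simpa [homCoord, mul_comm] using h
  refine ⟨fun i => φ (Pi.single (Sum.inr i) 1), -φ (Pi.single (Sum.inl ()) 1), ?_, ?_⟩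
  · intro hw
    have hw' : ∀ i, φ (Pi.single (Sum.inr i) 1) = 0 := fun i => congrFun hw i
    have h0 := hzero v₀ hv₀
    simp only [hw', zero_mul, Finset.sum_const_zero, add_zero] at h0
    exact hφ (LinearMap.ext fun u => by rw [hsum]; simp [hw', h0])
  · intro v h1 h2
    have := hzero v ⟨h1, h2⟩
    linarith

theorem abs_sum_mul_sub_lt {n : ℕ} {w y u : Fin n → ℝ} {b δ : ℝ} (hw : w ≠ 0)
    (hu : ∑ i, w i * u i = b) (hy : ‖y - u‖ < δ) :
    |∑ i, w i * y i - b| < δ * ∑ i, |w i| := by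
  have hpos : 0 < ∑ i, |w i| := by
    obtain ⟨i, hi⟩ := Function.ne_iff.mp hw
    exact Finset.sum_pos' (fun _ _ => abs_nonneg _) ⟨i, Finset.mem_univ i, abs_pos.mpr hi⟩
  calc |∑ i, w i * y i - b| = |∑ i, w i * (y - u) i| := by
        rw [← hu, ← Finset.sum_sub_distrib]
        simp [mul_sub]
    _ ≤ ∑ i, |w i * (y - u) i| := Finset.abs_sum_le_sum_abs _ _
    _ ≤ ∑ i, |w i| * ‖y - u‖ := by
        refine Finset.sum_le_sum fun i _ => ?_
        rw [abs_mul]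
        exact mul_le_mul_of_nonneg_left (norm_le_pi_norm (y - u) i) (abs_nonneg _)
    _ = ‖y - u‖ * ∑ i, |w i| := by rw [← Finset.sum_mul, mul_comm]
    _ < δ * ∑ i, |w i| := mul_lt_mul_of_pos_right hy hpos

/-- A slab of width comparable to the mesh contains few points of a grid. -/
theorem card_grid_slab_le {n : ℕ} (hn : 1 ≤ n) (L : ℕ) (z w : Fin n → ℝ) (b : ℝ) {η : ℝ}
    (hη : 0 < η) :
    (Finset.univ.filter fun k : Fin n → Fin L =>
      |∑ i, w i * (z i + η * (k i : ℕ)) - b| < η / 2 * ∑ i, |w i|).card ≤ L ^ (n - 1) * n := by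
  classical
  obtain ⟨i₀, -, hi₀⟩ := Finset.exists_max_image Finset.univ (fun i => |w i|)
    ⟨(⟨0, hn⟩ : Fin n), Finset.mem_univ _⟩
  have hS : ∑ i, |w i| ≤ n * |w i₀| := by
    have := Finset.sum_le_card_nsmul Finset.univ (fun i => |w i|) _ hi₀
    simpa using this
  let F : (Fin n → Fin L) → ({j : Fin n // j ≠ i₀} → Fin L) × Fin n :=
    fun k => (fun j => k j, ⟨(k i₀ : ℕ) % n, Nat.mod_lt _ hn⟩)
  have hcard : (Finset.univ : Finset (({j : Fin n // j ≠ i₀} → Fin L) × Fin n)).card =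
      L ^ (n - 1) * n := by
    simp [Fintype.card_subtype_compl]
  rw [← hcard]
  refine Finset.card_le_card_of_injOn F (fun _ _ => Finset.mem_coe.mpr (Finset.mem_univ _)) ?_
  intro k hk k' hk' hF
  simp only [Finset.coe_filter, Finset.mem_univ, true_and, Set.mem_ofPred_eq] at hk hk'
  simp only [F, Prod.mk.injEq, Fin.mk.injEq] at hF
  obtain ⟨hF1, hF2⟩ := hF
  have hoff : ∀ j, j ≠ i₀ → k j = k' j := fun j hj => congrFun hF1 ⟨j, hj⟩
  have hdiff : (∑ i, w i * (z i + η * (k i : ℕ)) - b) - (∑ i, w i * (z i + η * (k' i : ℕ)) - b) =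
      w i₀ * η * (((k i₀ : ℕ) : ℝ) - (k' i₀ : ℕ)) := by
    rw [sub_sub_sub_cancel_right, ← Finset.sum_sub_distrib,
      Finset.sum_eq_single i₀]
    · ring
    · intro j _ hj
      rw [hoff j hj]; ring
    · simp
  have habs : |w i₀| * η * |((k i₀ : ℕ) : ℝ) - (k' i₀ : ℕ)| < |w i₀| * η * n := by
    rw [← abs_of_pos hη, ← abs_mul, ← abs_mul, ← hdiff]
    calc _ ≤ _ := abs_sub _ _
      _ < η / 2 * ∑ i, |w i| + η / 2 * ∑ i, |w i| := add_lt_add hk hk'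
      _ = η * ∑ i, |w i| := by ring
      _ ≤ η * (n * |w i₀|) := by gcongr
      _ = _ := by rw [abs_mul, abs_of_pos hη]; ring
  have hlt := lt_of_mul_lt_mul_left habs (by positivity)
  have hlt' : |((k i₀ : ℕ) : ℤ) - (k' i₀ : ℕ)| < n := by exact_mod_cast hlt
  have hdvd : (n : ℤ) ∣ ((k i₀ : ℕ) : ℤ) - (k' i₀ : ℕ) :=
    (Nat.modEq_iff_dvd.mp (Nat.ModEq.symm hF2))
  have h0 := Int.eq_zero_of_abs_lt_dvd hdvd hlt'
  funext j
  by_cases hj : j = i₀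
  · subst hj
    exact Fin.ext (by omega)
  · exact hoff j hj

theorem exists_children_avoiding_hyperplane {n l : ℕ} (hn : 1 ≤ n) (hl : n ≤ l) (z : Fin n → ℝ)
    {ρ : ℝ} (hρ : 0 < ρ) {w : Fin n → ℝ} (hw : w ≠ 0) (b : ℝ) :
    ∃ g : Fin (l ^ n) → Fin n → ℝ,
      (∀ k, Metric.closedBall (g k) (ρ / (8 * l)) ⊆ Metric.closedBall z ρ) ∧
      (∀ k, ∀ y ∈ Metric.closedBall (g k) (ρ / (8 * l)), ∀ u : Fin n → ℝ,
        ∑ i, w i * u i = b → ρ / (8 * l) ≤ ‖y - u‖) ∧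
      ∀ k k', k ≠ k' → 4 * (ρ / (8 * l)) ≤ dist (g k) (g k') := by
  classical
  have hl0 : (0 : ℝ) < l := by exact_mod_cast (by omega : 0 < l)
  set η : ℝ := ρ / (2 * l) with hη
  have hη0 : 0 < η := by positivity
  have hη4 : ρ / (8 * l) = η / 4 := by rw [hη]; field_simp; norm_num
  set bad := Finset.univ.filter fun k : Fin n → Fin (2 * l) =>
      |∑ i, w i * (z i + η * (k i : ℕ)) - b| < η / 2 * ∑ i, |w i| with hbad
  have hcard : l ^ n ≤ (badᶜ).card := by
    have h1 := card_grid_slab_le hn (2 * l) z w b hη0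
    rw [Finset.card_compl]
    simp only [Fintype.card_fun, Fintype.card_fin]
    obtain ⟨m, rfl⟩ : ∃ m, n = m + 1 := ⟨n - 1, by omega⟩
    simp only [Nat.add_sub_cancel] at h1
    have h2 : (2 * l) ^ m * (m + 1) ≤ (2 * l) ^ m * l := Nat.mul_le_mul_left _ hl
    have h3 : l ^ (m + 1) ≤ (2 * l) ^ m * l := by
      rw [pow_succ]
      exact Nat.mul_le_mul_right _ (Nat.pow_le_pow_left (by omega) _)
    have h4 : (2 * l) ^ (m + 1) = (2 * l) ^ m * l + (2 * l) ^ m * l := by ring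
    have h5 : bad.card ≤ (2 * l) ^ m * (m + 1) := h1
    omega
  obtain ⟨e⟩ : Nonempty (Fin (l ^ n) ↪ {k // k ∈ badᶜ}) :=
    Function.Embedding.nonempty_of_card_le (by rwa [Fintype.card_fin, Fintype.card_coe])
  refine ⟨fun k i => z i + η * ((e k).1 i : ℕ), ?_, ?_, ?_⟩
  · intro k
    refine Metric.closedBall_subset_closedBall' ?_
    rw [hη4]
    have : dist (fun i => z i + η * ((e k).1 i : ℕ)) z ≤ η * (2 * l - 1) := by
      have hl1 : (1 : ℝ) ≤ l := by exact_mod_cast (by omega : 1 ≤ l)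
      rw [dist_pi_le_iff (by nlinarith)]
      intro i
      have hlt : (((e k).1 i : ℕ) : ℝ) + 1 ≤ 2 * l := by exact_mod_cast ((e k).1 i).2
      rw [Real.dist_eq, add_sub_cancel_left, abs_of_nonneg (by positivity)]
      gcongr
      linarith
    have h2 : η * (2 * l) = ρ := by rw [hη]; field_simp
    nlinarith
  · intro k y hy u hu
    rw [hη4] at hy ⊢
    by_contra! hlt
    have hk := (e k).2
    rw [Finset.mem_compl] at hk
    apply hk
    refine Finset.mem_filter.mpr ⟨Finset.mem_univ _, ?_⟩
    refine abs_sum_mul_sub_lt hw hu ?_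
    rw [← dist_eq_norm]
    refine (dist_triangle _ y _).trans_lt ?_
    rw [Metric.mem_closedBall, dist_comm] at hy
    rw [← dist_eq_norm] at hlt
    linarith
  · intro k k' hkk
    have hne : (e k).1 ≠ (e k').1 := fun h => hkk (e.injective (Subtype.ext h))
    obtain ⟨i, hi⟩ := Function.ne_iff.mp hne
    refine le_trans ?_ (dist_le_pi_dist _ _ i)
    rw [hη4, Real.dist_eq, add_sub_add_left_eq_sub, ← mul_sub, abs_mul, abs_of_pos hη0]
    have h1 : (1 : ℝ) ≤ |(((e k).1 i : ℕ) : ℝ) - ((e k').1 i : ℕ)| := by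
      have : ((e k).1 i : ℕ) ≠ ((e k').1 i : ℕ) := fun h => hi (Fin.ext h)
      have h2 : (1 : ℤ) ≤ |(((e k).1 i : ℕ) : ℤ) - ((e k').1 i : ℕ)| :=
        Int.one_le_abs (by omega)
      exact_mod_cast h2
    nlinarith

theorem commonDen_dvd_of_div {n : ℕ} (p : Fin n → ℤ) (q : ℕ) :
    commonDen (fun i => (p i : ℚ) / q) ∣ q := by
  refine Finset.lcm_dvd fun i _ => ?_
  have h := Rat.den_dvd (p i) q
  rw [Rat.divInt_eq_div] at h
  exact_mod_cast h

/-- Dirichlet's theorem on simultaneous approximation. -/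
theorem exists_rat_norm_sub_le {n : ℕ} (x : Fin n → ℝ) {N : ℕ} (hN : 0 < N) :
    ∃ v : Fin n → ℚ, commonDen v ≤ N ^ n ∧
      ‖x - fun i => (v i : ℝ)‖ ≤ 1 / (commonDen v * N) := by
  have hN' : (0 : ℝ) < N := by exact_mod_cast hN
  let F : Fin (N ^ n + 1) → Fin n → Fin N := fun k i =>
    ⟨⌊Int.fract ((k : ℕ) * x i) * N⌋₊, by
      rw [Nat.floor_lt (by positivity)]
      have := Int.fract_lt_one ((k : ℕ) * x i)
      nlinarith⟩
  obtain ⟨k, k', hne, hF⟩ := Fintype.exists_ne_map_eq_of_card_lt F (by simp)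
  wlog hlt : k < k' generalizing k k'
  · exact this k' k hne.symm hF.symm (lt_of_le_of_ne (not_lt.mp hlt) hne.symm)
  set q : ℕ := k' - k with hq
  have hq0 : 0 < q := Nat.sub_pos_of_lt hlt
  have hqle : q ≤ N ^ n := by have := k'.2; omega
  have hqcast : (q : ℝ) = (k' : ℕ) - (k : ℕ) := by
    rw [hq, Nat.cast_sub (le_of_lt hlt)]
  let p : Fin n → ℤ := fun i => ⌊((k' : ℕ) : ℝ) * x i⌋ - ⌊((k : ℕ) : ℝ) * x i⌋
  have hp : ∀ i, |q * x i - p i| ≤ 1 / N := by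
    intro i
    have h1 : (q : ℝ) * x i - p i =
        Int.fract (((k' : ℕ) : ℝ) * x i) - Int.fract (((k : ℕ) : ℝ) * x i) := by
      simp only [p, Int.fract, hqcast]
      push_cast
      ring
    have h2 : ⌊Int.fract (((k : ℕ) : ℝ) * x i) * N⌋₊ = ⌊Int.fract (((k' : ℕ) : ℝ) * x i) * N⌋₊ := by
      have := congrFun hF i
      simpa [F] using this
    have h3 := Nat.floor_le (a := Int.fract (((k : ℕ) : ℝ) * x i) * N) (by positivity)
    have h4 := Nat.lt_floor_add_one (Int.fract (((k : ℕ) : ℝ) * x i) * N)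
    have h5 := Nat.floor_le (a := Int.fract (((k' : ℕ) : ℝ) * x i) * N) (by positivity)
    have h6 := Nat.lt_floor_add_one (Int.fract (((k' : ℕ) : ℝ) * x i) * N)
    rw [← h2] at h5 h6
    rw [h1, le_div_iff₀ hN', ← abs_of_pos hN', ← abs_mul, abs_le]
    constructor <;> linarith
  have hdvd := commonDen_dvd_of_div p q
  have hle := Nat.le_of_dvd hq0 hdvd
  refine ⟨fun i => (p i : ℚ) / q, hle.trans hqle, ?_⟩
  have hd0 := commonDen_pos fun i => (p i : ℚ) / q
  have hd0' : (0 : ℝ) < commonDen fun i => (p i : ℚ) / q := by exact_mod_cast hd0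
  have hq0' : (0 : ℝ) < q := by exact_mod_cast hq0
  refine le_trans (b := 1 / ((q : ℝ) * N)) ?_ ?_
  · rw [pi_norm_le_iff_of_nonneg (by positivity)]
    intro i
    have h1 : x i - (((p i : ℚ) / q : ℚ) : ℝ) = (q * x i - p i) / q := by
      push_cast
      field_simp
    rw [Pi.sub_apply, h1, Real.norm_eq_abs, abs_div, abs_of_pos hq0', div_le_iff₀ hq0']
    refine (hp i).trans (le_of_eq ?_)
    field_simp
  · have : ((commonDen fun i => (p i : ℚ) / q : ℕ) : ℝ) ≤ q := by exact_mod_cast hle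
    gcongr

/-- The Hausdorff–Cantelli lemma. -/
theorem hausdorffMeasure_setOf_infinite_eq_zero {X ι : Type*} [EMetricSpace X] [MeasurableSpace X]
    [BorelSpace X] [Countable ι] (t : ι → Set X) {s : ℝ} (hs : 0 < s)
    (hsum : ∑' i, Metric.ediam (t i) ^ s ≠ ∞) :
    μH[s] {x | {i | x ∈ t i}.Infinite} = 0 := by
  have htail := ENNReal.tendsto_tsum_compl_atTop_zero hsum
  have hroot : Tendsto (fun F : Finset ι => (∑' i : {i // i ∉ F}, Metric.ediam (t i) ^ s) ^ s⁻¹)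
      atTop (nhds 0) := by
    have h := ((ENNReal.continuous_rpow_const (y := s⁻¹)).tendsto 0).comp htail
    rwa [ENNReal.zero_rpow_of_pos (inv_pos.mpr hs)] at h
  have h := Measure.hausdorffMeasure_le_liminf_tsum s {x | {i | x ∈ t i}.Infinite} _ hroot
    (fun F (i : {i // i ∉ F}) => t i)
    (Eventually.of_forall fun F i => by
      rw [← ENNReal.rpow_rpow_inv hs.ne' (Metric.ediam (t i))]
      gcongr
      exact ENNReal.le_tsum (f := fun i : {i // i ∉ F} => Metric.ediam (t i) ^ s) i)
    (Eventually.of_forall fun F x hx => by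
      obtain ⟨i, hi, hiF⟩ := hx.exists_notMem_finset F
      exact Set.mem_iUnion.mpr ⟨⟨i, hiF⟩, hi⟩)
  rw [htail.liminf_eq] at h
  exact le_antisymm h zero_le

theorem summable_pow_mul_rpow_of_le {n R : ℕ} {ψ : ℕ → ℝ} (hψ0 : ∀ q, 0 ≤ ψ q) {C τ s : ℝ}
    (hψ : ∀ q : ℕ, 1 ≤ q → ψ q ≤ C * (q : ℝ) ^ (-τ)) (hs : 0 < s) (hsτ : n + 1 < s * τ) :
    Summable fun q : ℕ => ((2 * R * q + 1 : ℕ) : ℝ) ^ n * (2 * ψ q) ^ s := by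
  have hC : 0 ≤ C := by
    have h1 := (hψ0 1).trans (hψ 1 le_rfl)
    simpa using h1
  refine summable_of_isBigO_nat (g := fun q : ℕ => (q : ℝ) ^ ((n : ℝ) - s * τ))
    (Real.summable_nat_rpow.mpr (by linarith)) ?_
  refine Asymptotics.IsBigO.of_bound ((2 * R + 1 : ℝ) ^ n * (2 * C) ^ s) ?_
  filter_upwards [eventually_ge_atTop 1] with q hq
  have hq' : (1 : ℝ) ≤ q := by exact_mod_cast hq
  have hq0 : (0 : ℝ) < q := by linarith
  have h2 : 0 ≤ 2 * ψ q := by have := hψ0 q; positivity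
  rw [Real.norm_of_nonneg (by positivity), Real.norm_of_nonneg (by positivity)]
  calc ((2 * R * q + 1 : ℕ) : ℝ) ^ n * (2 * ψ q) ^ s
      ≤ ((2 * R + 1) * q) ^ n * (2 * (C * (q : ℝ) ^ (-τ))) ^ s := by
        gcongr
        · push_cast; nlinarith
        · exact hψ q hq
    _ = (2 * R + 1 : ℝ) ^ n * (2 * C) ^ s * ((q : ℝ) ^ n * (q : ℝ) ^ (-(s * τ))) := by
        rw [← mul_assoc 2 C, mul_pow, Real.mul_rpow (by positivity) (by positivity),
          ← Real.rpow_mul hq0.le]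
        ring_nf
    _ = _ := by
        rw [← Real.rpow_natCast (q : ℝ) n, ← Real.rpow_add hq0]
        rfl

theorem dimH_Wapprox_le {n : ℕ} {ψ : ℕ → ℝ} (hpos : ∀ s, 0 < ψ s) (hanti : Antitone ψ) {C τ : ℝ}
    (hψ : ∀ q : ℕ, 1 ≤ q → ψ q ≤ C * (q : ℝ) ^ (-τ)) {s : ℝ≥0} (hs : 0 < s)
    (hsτ : n + 1 < (s : ℝ) * τ) : dimH (Wapprox n ψ) ≤ s := by
  have hcover : Wapprox n ψ ⊆ ⋃ R : ℕ, Wapprox n ψ ∩ Metric.closedBall 0 R := by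
    intro x hx
    obtain ⟨R, hR⟩ := exists_nat_ge ‖x‖
    exact Set.mem_iUnion.mpr ⟨R, hx, by simpa using hR⟩
  refine (dimH_mono hcover).trans ?_
  rw [dimH_iUnion]
  refine iSup_le fun R₀ => dimH_le_of_hausdorffMeasure_ne_top ?_
  obtain ⟨R, hR⟩ := exists_nat_ge (R₀ + ψ 0)
  let center : (Σ q : ℕ, Fin n → Fin (2 * R * q + 1)) → Fin n → ℚ :=
    fun i j => (((i.2 j : ℕ) : ℚ) - R * i.1) / i.1
  let t : (Σ q : ℕ, Fin n → Fin (2 * R * q + 1)) → Set (Fin n → ℝ) :=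
    fun i => Metric.closedBall (fun j => (center i j : ℝ)) (ψ i.1)
  have hsum : ∑' i, Metric.ediam (t i) ^ (s : ℝ) ≠ ∞ := by
    have hle : ∑' i, Metric.ediam (t i) ^ (s : ℝ) ≤
        ∑' q : ℕ, ENNReal.ofReal (((2 * R * q + 1 : ℕ) : ℝ) ^ n * (2 * ψ q) ^ (s : ℝ)) := by
      rw [ENNReal.tsum_sigma']
      refine ENNReal.tsum_le_tsum fun q => ?_
      have h2 : 0 ≤ 2 * ψ q := by have := hpos q; positivity
      have hb : ∀ p, Metric.ediam (t ⟨q, p⟩) ^ (s : ℝ) ≤ ENNReal.ofReal ((2 * ψ q) ^ (s : ℝ)) := by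
        intro p
        rw [← ENNReal.ofReal_rpow_of_nonneg h2 s.coe_nonneg]
        gcongr
        refine Metric.ediam_le_of_forall_dist_le fun x hx y hy => ?_
        have h3 := dist_triangle_right x y (fun j => (center ⟨q, p⟩ j : ℝ))
        have h4 := Metric.mem_closedBall.mp hx
        have h5 := Metric.mem_closedBall.mp hy
        simp only at h4 h5
        linarith
      refine (ENNReal.tsum_le_tsum hb).trans ?_
      rw [tsum_fintype, Finset.sum_const, Finset.card_univ, nsmul_eq_mul,
        ENNReal.ofReal_mul (by positivity)]
      gcongr
      rw [ENNReal.ofReal_pow (by positivity), ENNReal.ofReal_natCast]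
      simp
    refine ne_top_of_le_ne_top ?_ hle
    have hsm := summable_pow_mul_rpow_of_le (n := n) (R := R) (fun q => (hpos q).le) hψ
      (NNReal.coe_pos.mpr hs) hsτ
    exact hsm.tsum_ofReal_ne_top
  have hzero := hausdorffMeasure_setOf_infinite_eq_zero t (NNReal.coe_pos.mpr hs) hsum
  refine (measure_mono_null ?_ hzero).trans_ne (by simp)
  rintro x ⟨hx, hxR⟩
  have hsub : {v : Fin n → ℚ | ‖x - fun i => (v i : ℝ)‖ < ψ (commonDen v)} ⊆
      center '' {i | x ∈ t i} := by
    intro v hv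
    have hd0 : (0 : ℝ) < commonDen v := by exact_mod_cast commonDen_pos v
    choose p hp using exists_intCast_eq_mul_commonDen v
    have hvR : ∀ j, |(v j : ℝ)| ≤ R := by
      intro j
      have h1 : ‖(fun i => (v i : ℝ))‖ ≤ ‖x‖ + ‖x - fun i => (v i : ℝ)‖ := by
        rw [norm_sub_rev]
        simpa using norm_add_le x ((fun i => (v i : ℝ)) - x)
      have h2 := norm_le_pi_norm (fun i => (v i : ℝ)) j
      have h3 : ‖x‖ ≤ R₀ := by simpa using hxR
      have h4 : ψ (commonDen v) ≤ ψ 0 := hanti (Nat.zero_le _)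
      have h5 : ‖x - fun i => (v i : ℝ)‖ < ψ (commonDen v) := hv
      rw [Real.norm_eq_abs] at h2
      linarith
    have hpR : ∀ j, |p j| ≤ R * commonDen v := by
      intro j
      have h1 : |(p j : ℝ)| ≤ R * commonDen v := by
        rw [hp j, abs_mul, abs_of_pos hd0]
        exact mul_le_mul_of_nonneg_right (hvR j) hd0.le
      exact_mod_cast h1
    have hbound : ∀ j, (p j + R * commonDen v).toNat < 2 * R * commonDen v + 1 := by
      intro j
      have h1 := abs_le.mp (hpR j)
      have h2 : ((2 * R * commonDen v : ℕ) : ℤ) = R * commonDen v + R * commonDen v := by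
        push_cast; ring
      omega
    have hcenter : center ⟨commonDen v, fun j => ⟨_, hbound j⟩⟩ = v := by
      funext j
      have h1 := abs_le.mp (hpR j)
      have h2 : (((p j + R * commonDen v).toNat : ℤ) : ℚ) = p j + R * commonDen v := by
        rw [Int.toNat_of_nonneg (by linarith)]
        push_cast; ring
      have h3 : (p j : ℚ) = v j * commonDen v := by exact_mod_cast hp j
      have hd0' : (commonDen v : ℚ) ≠ 0 := by exact_mod_cast hd0.ne'
      simp only [center]
      rw [Int.cast_natCast] at h2
      rw [h2, h3, add_sub_cancel_right, mul_div_cancel_right₀ _ hd0']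
    refine ⟨_, ?_, hcenter⟩
    change x ∈ Metric.closedBall _ _
    rw [hcenter, Metric.mem_closedBall, dist_eq_norm]
    exact le_of_lt hv
  exact Set.Infinite.of_image _ (hx.mono hsub)

theorem exists_comparable_scale {ψ : ℕ → ℝ} (hpos : ∀ s, 0 < ψ s) (hanti : Antitone ψ) {τ : ℝ}
    (hτ : 0 < τ) (hunb : ∀ C : ℝ, ∃ q : ℕ, 1 ≤ q ∧ C * (q : ℝ) ^ (-τ) < ψ q) {B : ℕ} (hB : 2 ≤ B)
    (k₀ : ℕ) :
    ∃ k ≥ k₀, ((B ^ (k + 1) : ℕ) : ℝ) ^ (-τ) ≤ ψ (B ^ (k + 1)) ∧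
      ψ (B ^ k) ≤ (B : ℝ) ^ τ * ψ (B ^ (k + 1)) := by
  classical
  have hB0 : (0 : ℝ) < B := by exact_mod_cast (by omega : 0 < B)
  let f : ℕ → ℝ := fun k => ψ (B ^ k) * ((B : ℝ) ^ k) ^ τ
  have hf0 : ∀ k, 0 < f k := fun k => mul_pos (hpos _) (by positivity)
  have hf : ∀ C : ℝ, 0 < C → ∃ k, C < f k := by
    intro C hC
    obtain ⟨q, hq, hCq⟩ := hunb (C * (B : ℝ) ^ τ)
    have hq0 : (0 : ℝ) < q := by exact_mod_cast hq
    refine ⟨Nat.log B q, ?_⟩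
    have h1 : B ^ Nat.log B q ≤ q := Nat.pow_log_le_self B (by omega)
    have h2 : (q : ℝ) ≤ B * (B : ℝ) ^ Nat.log B q := by
      have := (Nat.lt_pow_succ_log_self (by omega : 1 < B) q).le
      rw [pow_succ'] at this
      exact_mod_cast this
    have h3 : (q : ℝ) ^ τ ≤ (B : ℝ) ^ τ * ((B : ℝ) ^ Nat.log B q) ^ τ := by
      rw [← Real.mul_rpow hB0.le (by positivity)]
      exact Real.rpow_le_rpow hq0.le h2 hτ.le
    have h4 : C * (B : ℝ) ^ τ < ψ q * (q : ℝ) ^ τ := by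
      rw [Real.rpow_neg hq0.le, ← div_eq_mul_inv, div_lt_iff₀ (by positivity)] at hCq
      exact hCq
    have h5 : C * (B : ℝ) ^ τ < f (Nat.log B q) * (B : ℝ) ^ τ := by
      calc C * (B : ℝ) ^ τ < ψ q * (q : ℝ) ^ τ := h4
        _ ≤ ψ (B ^ Nat.log B q) * ((B : ℝ) ^ τ * ((B : ℝ) ^ Nat.log B q) ^ τ) := by
            gcongr
            · exact (hpos _).le
            · exact hanti h1
        _ = _ := by simp only [f]; ring
    exact lt_of_mul_lt_mul_right h5 (by positivity)
  set C : ℝ := 1 + ∑ k ∈ Finset.range (k₀ + 1), f k with hC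
  have hsum : 0 ≤ ∑ k ∈ Finset.range (k₀ + 1), f k := Finset.sum_nonneg fun k _ => (hf0 k).le
  have hex := hf C (by linarith)
  have hspec := Nat.find_spec hex
  have hmin := fun m => Nat.find_min hex (m := m)
  set m := Nat.find hex with hm
  have hmk : k₀ < m := by
    by_contra! hle
    have : f m ≤ ∑ k ∈ Finset.range (k₀ + 1), f k :=
      Finset.single_le_sum (f := f) (fun k _ => (hf0 k).le) (Finset.mem_range.mpr (by omega))
    linarith
  obtain ⟨k, hk⟩ : ∃ k, m = k + 1 := ⟨m - 1, by omega⟩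
  have hlow : f k ≤ C := not_lt.mp (hmin k (by omega))
  rw [hk] at hspec
  refine ⟨k, by omega, ?_, ?_⟩
  · have h1 : 1 ≤ ψ (B ^ (k + 1)) * ((B : ℝ) ^ (k + 1)) ^ τ := by
      have : C < f (k + 1) := hspec
      simp only [f] at this
      linarith
    push_cast
    rw [Real.rpow_neg (by positivity), inv_le_iff_one_le_mul₀ (by positivity)]
    exact h1
  · have h1 : ψ (B ^ k) * ((B : ℝ) ^ k) ^ τ ≤
        ((B : ℝ) ^ τ * ψ (B ^ (k + 1))) * ((B : ℝ) ^ k) ^ τ := by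
      have h2 : f k ≤ f (k + 1) := hlow.trans hspec.le
      simp only [f] at h2
      rw [pow_succ (B : ℝ) k, Real.mul_rpow (by positivity) hB0.le] at h2
      linarith
    exact le_of_mul_le_mul_right h1 (by positivity)

/-- `N` is admissible for relocating a cube of radius `r` at depth `i` of the Cantor construction
to a neighbourhood of a rational point of denominator at most `N ^ n`; here `σ` bounds below the
radii which were reached before the last relocation. -/
structure IsJumpScale (n : ℕ) (ψ : ℕ → ℝ) (M κ A K P s : ℝ) (i : ℕ) (r σ : ℝ) (N : ℕ) : Prop where
  pos : 0 < N
  large : M / σ < N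
  le_mul : A ≤ (N : ℝ) ^ (n + 1) * r
  inner : ψ (N ^ n) ≤ r
  doubling : ∀ d : ℕ, κ < (d : ℝ) ^ (n + 1) * (M * r) ^ n → ψ d ≤ K * ψ (N ^ n)
  mass : (P ^ i)⁻¹ ≤ (ψ (N ^ n) / 2) ^ s

theorem exists_isJumpScale {n : ℕ} (hn : 1 ≤ n) {ψ : ℕ → ℝ} (hpos : ∀ s, 0 < ψ s)
    (hanti : Antitone ψ)
    (hsmall : Tendsto (fun s : ℕ => (s : ℝ) ^ (((n : ℝ) + 1) / n) * ψ s) atTop (nhds 0))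
    {τ : ℝ} (hτ : 0 < τ) (hunb : ∀ C : ℝ, ∃ q : ℕ, 1 ≤ q ∧ C * (q : ℝ) ^ (-τ) < ψ q)
    {M κ A P s s' : ℝ} (hM : 1 < M) (hκ : 0 < κ) (hA : 0 < A) (hs : 0 < s) (hs' : 0 < s')
    (hP : M ^ s' ≤ P) (hss' : n * τ * s < (n + 1) * s') {b : ℕ} (hb : 2 ≤ b)
    (hbA : (A * M ^ 2) ^ n / κ ≤ b) (i₀ : ℕ) {ρ : ℝ} (σ : ℝ) (hρ : 0 < ρ) :
    ∃ t ≥ 1, ∃ N, IsJumpScale n ψ M κ A (((b ^ n : ℕ) : ℝ) ^ τ) P s (i₀ + t) (ρ / M ^ t) σ N := by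
  have hM0 : 0 < M := by linarith
  have hn0 : (0 : ℝ) < n := by exact_mod_cast hn
  have e1 : ∀ᶠ N : ℕ in atTop, M / σ < N := tendsto_natCast_atTop_atTop.eventually_gt_atTop _
  have e2 : ∀ᶠ N : ℕ in atTop, A * M / ρ ≤ N := tendsto_natCast_atTop_atTop.eventually_ge_atTop _
  have e3 : ∀ᶠ N : ℕ in atTop, (N : ℝ) ^ (n + 1) * ψ (N ^ n) ≤ A := by
    have h1 := hsmall.comp (tendsto_pow_atTop (α := ℕ) (n := n) (by omega))
    filter_upwards [h1.eventually_le_const hA] with N hN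
    refine le_trans (le_of_eq ?_) hN
    simp only [Function.comp]
    congr 1
    push_cast
    rw [← Real.rpow_natCast, ← Real.rpow_natCast, ← Real.rpow_mul (by positivity)]
    congr 1
    push_cast
    field_simp
  have e4 : ∀ᶠ N : ℕ in atTop,
      (A * M / ρ) ^ s' * 2 ^ s ≤ (N : ℝ) ^ ((n + 1) * s' - n * τ * s) :=
    ((tendsto_rpow_atTop (by linarith)).comp tendsto_natCast_atTop_atTop).eventually_ge_atTop _
  obtain ⟨N₀, hN₀⟩ := eventually_atTop.mp (e1.and (e2.and (e3.and e4)))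
  have hB : 2 ≤ b ^ n := hb.trans (Nat.le_self_pow (by omega) b)
  obtain ⟨k, hk, hlow, hdoub⟩ := exists_comparable_scale hpos hanti hτ hunb hB N₀
  set N : ℕ := b ^ (k + 1) with hN
  have hBN : (b ^ n) ^ (k + 1) = N ^ n := by rw [hN, ← pow_mul, ← pow_mul, mul_comm]
  rw [hBN] at hlow hdoub
  have hNk : k + 1 < N := Nat.lt_pow_self (by omega)
  obtain ⟨h1, h2, h3, h4⟩ := hN₀ N (by omega)
  have hN0 : 0 < N := by omega
  have hN0' : (0 : ℝ) < N := by exact_mod_cast hN0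
  have hN1 : (1 : ℝ) ≤ N := by exact_mod_cast hN0
  set x : ℝ := (N : ℝ) ^ (n + 1) * ρ / A with hx
  have hx0 : 0 < x := by positivity
  have hxM : M ≤ x := by
    rw [hx, le_div_iff₀ hA]
    rw [div_le_iff₀ hρ] at h2
    have : (N : ℝ) * ρ ≤ (N : ℝ) ^ (n + 1) * ρ := by
      gcongr
      exact le_self_pow₀ hN1 (by omega)
    linarith
  obtain ⟨t, ht1, ht2⟩ := exists_nat_pow_near (hM.le.trans hxM) hM
  have ht : 1 ≤ t := by
    by_contra! h
    have : t = 0 := by omega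
    subst this
    simp only [zero_add, pow_one] at ht2
    linarith
  have hMt : 0 < M ^ t := by positivity
  have hr1 : A / (N : ℝ) ^ (n + 1) ≤ ρ / M ^ t := by
    rw [div_le_div_iff₀ (by positivity) hMt]
    rw [hx, le_div_iff₀ hA] at ht1
    linarith
  have hr2 : M * (ρ / M ^ t) ≤ A * M ^ 2 / (N : ℝ) ^ (n + 1) := by
    rw [hx, div_lt_iff₀ hA] at ht2
    rw [mul_div_assoc', div_le_div_iff₀ hMt (by positivity)]
    rw [pow_succ M t] at ht2
    nlinarith
  have hr3 : (M ^ t)⁻¹ ≤ A * M / ρ * ((N : ℝ) ^ (n + 1))⁻¹ := by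
    rw [hx, div_lt_iff₀ hA, pow_succ M t] at ht2
    rw [← div_eq_mul_inv, div_div, inv_eq_one_div, div_le_div_iff₀ hMt (by positivity)]
    nlinarith
  refine ⟨t, ht, N, hN0, h1, ?_, ?_, ?_, ?_⟩
  · rw [div_le_iff₀ (by positivity)] at hr1
    linarith
  · refine le_trans ?_ hr1
    rw [le_div_iff₀ (by positivity)]
    linarith
  · intro d hd
    refine le_trans (hanti ?_) hdoub
    by_contra! hlt
    have hd1 : (d : ℝ) ^ (n + 1) ≤ ((b : ℝ) ^ (n * k)) ^ (n + 1) := by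
      gcongr
      rw [← pow_mul] at hlt
      exact_mod_cast hlt.le
    have hd2 : κ < ((b : ℝ) ^ (n * k)) ^ (n + 1) * (A * M ^ 2 / (N : ℝ) ^ (n + 1)) ^ n := by
      refine hd.trans_le ?_
      gcongr
    have hNb : ((N : ℝ) ^ (n + 1)) ^ n =
        (b : ℝ) ^ (n * (n + 1)) * ((b : ℝ) ^ (n * k)) ^ (n + 1) := by
      rw [hN]; push_cast
      rw [← pow_mul, ← pow_mul, ← pow_mul, ← pow_add]
      congr 1; ring
    have hb0 : (0 : ℝ) < b := by exact_mod_cast (by omega : 0 < b)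
    rw [div_pow, hNb, mul_div_assoc', mul_comm ((b : ℝ) ^ (n * (n + 1))),
      mul_div_mul_left _ _ (by positivity), lt_div_iff₀ (by positivity)] at hd2
    rw [div_le_iff₀ hκ] at hbA
    have : (b : ℝ) ≤ (b : ℝ) ^ (n * (n + 1)) := by
      refine le_self_pow₀ (by exact_mod_cast (by omega : 1 ≤ b)) ?_
      exact Nat.mul_ne_zero (by omega) (by omega)
    nlinarith
  · have hP1 : 1 ≤ P := (Real.one_le_rpow hM.le hs'.le).trans hP
    calc (P ^ (i₀ + t))⁻¹ ≤ (P ^ t)⁻¹ := by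
          gcongr
          omega
      _ ≤ ((M ^ s') ^ t)⁻¹ := by gcongr
      _ = ((M ^ t)⁻¹) ^ s' := by
          rw [Real.inv_rpow hMt.le, ← Real.rpow_natCast, ← Real.rpow_natCast,
            ← Real.rpow_mul hM0.le, ← Real.rpow_mul hM0.le, mul_comm]
      _ ≤ (A * M / ρ * ((N : ℝ) ^ (n + 1))⁻¹) ^ s' := by gcongr
      _ = (A * M / ρ) ^ s' * (N : ℝ) ^ (-((n + 1) * s')) := by
          rw [Real.mul_rpow (by positivity) (by positivity), Real.inv_rpow (by positivity),
            ← Real.rpow_natCast, ← Real.rpow_mul hN0'.le, ← Real.rpow_neg hN0'.le]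
          push_cast
          rfl
      _ ≤ ((N : ℝ) ^ (-(n * τ)) / 2) ^ s := by
          rw [Real.div_rpow (by positivity : 0 ≤ (N : ℝ) ^ (-(n * τ))) (by positivity) s,
            le_div_iff₀ (by positivity),
            ← Real.rpow_mul hN0'.le]
          calc _ = ((A * M / ρ) ^ s' * 2 ^ s) * (N : ℝ) ^ (-((n + 1) * s')) := by ring
            _ ≤ (N : ℝ) ^ ((n + 1) * s' - n * τ * s) * (N : ℝ) ^ (-((n + 1) * s')) := by gcongr
            _ = _ := by rw [← Real.rpow_add hN0']; ring_nf
      _ ≤ (ψ (N ^ n) / 2) ^ s := by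
          gcongr
          refine le_trans (le_of_eq ?_) hlow
          push_cast
          rw [← Real.rpow_natCast, ← Real.rpow_mul hN0'.le]
          ring_nf

/-- A sequence of radii `ρ i` for the Cantor construction. At a level with `N i = 0` the radius is
divided by `M`; at any other level the construction relocates to a rational point. -/
structure IsCantorScale (n : ℕ) (ψ : ℕ → ℝ) (M κ A K P s : ℝ) (ρ σ : ℕ → ℝ) (N : ℕ → ℕ) : Prop where
  pos : ∀ i, 0 < ρ i
  aux_pos : ∀ i, 0 < σ i
  aux_zero_le : σ 0 ≤ ρ 0
  index_zero : N 0 = 0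
  succ : ∀ i, (N (i + 1) = 0 ∧ ρ (i + 1) = ρ i / M ∧ σ (i + 1) = σ i) ∨
    (IsJumpScale n ψ M κ A K P s (i + 1) (ρ i / M) (σ i) (N (i + 1)) ∧
      ρ (i + 1) = ψ (N (i + 1) ^ n) / 2 ∧ σ (i + 1) = ρ (i + 1))
  frequently : ∀ i, ∃ m ≥ i, N m ≠ 0
  mass : ∀ i, (P ^ i)⁻¹ ≤ ρ i ^ s

theorem exists_isCantorScale {n : ℕ} {ψ : ℕ → ℝ} (hpos : ∀ s, 0 < ψ s) {M κ A K P s : ℝ}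
    (hM : 1 < M) (hP : 0 < P) (hPs : M ^ s ≤ P)
    (hjump : ∀ (i₀ : ℕ) (ρ σ : ℝ), 0 < ρ →
      ∃ t ≥ 1, ∃ N, IsJumpScale n ψ M κ A K P s (i₀ + t) (ρ / M ^ t) σ N) :
    ∃ (ρ σ : ℕ → ℝ) (N : ℕ → ℕ), IsCantorScale n ψ M κ A K P s ρ σ N := by
  classical
  have hM0 : 0 < M := by linarith
  let next : ℕ → ℝ × ℝ × ℕ → ℝ × ℝ × ℕ := fun i u =>
    if h : ∃ N, IsJumpScale n ψ M κ A K P s (i + 1) (u.1 / M) u.2.1 N then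
      (ψ (h.choose ^ n) / 2, ψ (h.choose ^ n) / 2, h.choose)
    else (u.1 / M, u.2.1, 0)
  let u : ℕ → ℝ × ℝ × ℕ := fun i => Nat.rec (1, 1, 0) next i
  have hu : ∀ i, u (i + 1) = next i (u i) := fun i => rfl
  have hfree : ∀ i, (¬ ∃ N, IsJumpScale n ψ M κ A K P s (i + 1) ((u i).1 / M) (u i).2.1 N) →
      u (i + 1) = ((u i).1 / M, (u i).2.1, 0) := fun i h => by
    rw [hu]; simp only [next]; rw [dif_neg h]
  have hstep : ∀ i, ((u (i + 1)).2.2 = 0 ∧ (u (i + 1)).1 = (u i).1 / M ∧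
      (u (i + 1)).2.1 = (u i).2.1) ∨
        (IsJumpScale n ψ M κ A K P s (i + 1) ((u i).1 / M) (u i).2.1 (u (i + 1)).2.2 ∧
          (u (i + 1)).1 = ψ ((u (i + 1)).2.2 ^ n) / 2 ∧ (u (i + 1)).2.1 = (u (i + 1)).1) := by
    intro i
    by_cases h : ∃ N, IsJumpScale n ψ M κ A K P s (i + 1) ((u i).1 / M) (u i).2.1 N
    · right
      have h1 : u (i + 1) = (ψ (h.choose ^ n) / 2, ψ (h.choose ^ n) / 2, h.choose) := by
        rw [hu]; simp only [next]; rw [dif_pos h]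
      rw [h1]
      exact ⟨h.choose_spec, rfl, rfl⟩
    · left
      rw [hfree i h]
      exact ⟨rfl, rfl, rfl⟩
  have hu0 : ∀ i, 0 < (u i).1 ∧ 0 < (u i).2.1 := by
    intro i
    induction i with
    | zero => exact ⟨one_pos, one_pos⟩
    | succ i ih =>
      rcases hstep i with ⟨-, h1, h2⟩ | ⟨-, h1, h2⟩
      · rw [h1, h2]
        exact ⟨div_pos ih.1 hM0, ih.2⟩
      · rw [h2, h1]
        have := hpos ((u (i + 1)).2.2 ^ n)
        constructor <;> positivity
  refine ⟨fun i => (u i).1, fun i => (u i).2.1, fun i => (u i).2.2, fun i => (hu0 i).1,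
    fun i => (hu0 i).2, le_refl (1 : ℝ), rfl, hstep, ?_, ?_⟩
  · intro i₀
    by_contra! hno
    have hN0 : ∀ i, i₀ ≤ i + 1 →
        ¬ ∃ N, IsJumpScale n ψ M κ A K P s (i + 1) ((u i).1 / M) (u i).2.1 N := by
      intro i hi h
      have h1 : u (i + 1) = (ψ (h.choose ^ n) / 2, ψ (h.choose ^ n) / 2, h.choose) := by
        rw [hu]; simp only [next]; rw [dif_pos h]
      have h2 := hno (i + 1) hi
      rw [h1] at h2
      exact h.choose_spec.pos.ne' h2
    have hform : ∀ t, (u (i₀ + t)).1 = (u i₀).1 / M ^ t ∧ (u (i₀ + t)).2.1 = (u i₀).2.1 := by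
      intro t
      induction t with
      | zero => simp
      | succ t ih =>
        rw [← add_assoc, hfree (i₀ + t) (hN0 _ (by omega))]
        refine ⟨?_, ih.2⟩
        simp only
        rw [ih.1, pow_succ, div_div]
    obtain ⟨t, ht, N, hN⟩ := hjump i₀ _ (u i₀).2.1 (hu0 i₀).1
    obtain ⟨t, rfl⟩ : ∃ t', t = t' + 1 := ⟨t - 1, by omega⟩
    refine hN0 (i₀ + t) (by omega) ⟨N, ?_⟩
    rw [(hform t).1, (hform t).2, div_div, ← pow_succ]
    exact hN
  · intro i
    induction i with
    | zero => simp [u]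
    | succ i ih =>
      rcases hstep i with ⟨-, h1, -⟩ | ⟨h, h1, -⟩
      · simp only [h1]
        rw [Real.div_rpow (hu0 i).1.le hM0.le, pow_succ, mul_inv, div_eq_mul_inv]
        have : 0 < M ^ s := by positivity
        gcongr
        exact Real.rpow_nonneg (hu0 i).1.le s
      · simp only [h1]
        exact h.mass

/-- The radius of the cubes which are subdivided at level `i` of the Cantor construction. -/
noncomputable def parentRadius (M : ℝ) (ρ : ℕ → ℝ) : ℕ → ℝ
  | 0 => ρ 0
  | i + 1 => ρ i / M

/-- The condition imposed at level `m` of the Cantor construction. -/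
def approxCond (n : ℕ) (κ M : ℝ) (ρ : ℕ → ℝ) (N : ℕ → ℕ) (m : ℕ) : Set (Fin n → ℝ) :=
  {y | (∀ v : Fin n → ℚ, (commonDen v : ℝ) ^ (n + 1) * ρ m ^ n ≤ κ →
      ρ m / M ≤ ‖y - fun i => (v i : ℝ)‖) ∧
    (N m ≠ 0 → ∃ v : Fin n → ℚ, commonDen v ≤ N m ^ n ∧ ‖y - fun i => (v i : ℝ)‖ ≤ ρ m)}

namespace IsCantorScale

variable {n : ℕ} {ψ : ℕ → ℝ} {M κ A K P s : ℝ} {ρ σ : ℕ → ℝ} {N : ℕ → ℕ}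

theorem succ_le (h : IsCantorScale n ψ M κ A K P s ρ σ N) (hM : 1 < M) (i : ℕ) :
    ρ (i + 1) ≤ ρ i / M := by
  rcases h.succ i with ⟨-, h1, -⟩ | ⟨h1, h2, -⟩
  · exact h1.le
  · have h3 := h1.inner
    have : 0 < ρ i / M := div_pos (h.pos i) (by linarith)
    linarith

theorem antitone (h : IsCantorScale n ψ M κ A K P s ρ σ N) (hM : 1 < M) : Antitone ρ :=
  antitone_nat_of_succ_le fun i => (h.succ_le hM i).trans (div_le_self (h.pos i).le hM.le)

theorem tendsto_zero (h : IsCantorScale n ψ M κ A K P s ρ σ N) (hM : 1 < M) :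
    Tendsto ρ atTop (nhds 0) := by
  have hle : ∀ i, ρ i ≤ ρ 0 * M⁻¹ ^ i := by
    intro i
    induction i with
    | zero => simp
    | succ i ih =>
      refine (h.succ_le hM i).trans ?_
      rw [pow_succ, ← mul_assoc, div_eq_mul_inv]
      have : 0 < M := by linarith
      gcongr
  refine squeeze_zero (fun i => (h.pos i).le) hle ?_
  have := (tendsto_pow_atTop_nhds_zero_of_lt_one (inv_nonneg.mpr (by linarith : 0 ≤ M))
    (inv_lt_one_of_one_lt₀ hM)).const_mul (ρ 0)
  simpa using this

theorem aux_le_or (h : IsCantorScale n ψ M κ A K P s ρ σ N) (hM : 1 < M) (i : ℕ) :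
    ∀ m ≤ i, σ i ≤ ρ m ∨ ∃ m', m = m' + 1 ∧ ρ m = ρ m' / M := by
  induction i with
  | zero =>
    intro m hm
    obtain rfl : m = 0 := by omega
    exact Or.inl h.aux_zero_le
  | succ i ih =>
    intro m hm
    rcases h.succ i with ⟨-, h1, h2⟩ | ⟨-, -, h2⟩
    · rcases hm.lt_or_eq with hm | rfl
      · rw [h2]
        exact ih m (by omega)
      · exact Or.inr ⟨i, rfl, h1⟩
    · rw [h2]
      exact Or.inl (h.antitone hM hm)

theorem exists_rat_near (h : IsCantorScale n ψ M κ A K P s ρ σ N) (hM : 1 < M) (hκ : 0 < κ)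
    (hA : 2 ^ (n + 1) * M ^ n / κ ≤ A) (hA' : 2 * M ^ (2 * n) / κ ≤ A) {i : ℕ} (hi : N (i + 1) ≠ 0)
    {x : Fin n → ℝ} (hx : ∀ m ≤ i, ∀ v : Fin n → ℚ, (commonDen v : ℝ) ^ (n + 1) * ρ m ^ n ≤ κ →
      ρ m / M ≤ ‖x - fun i => (v i : ℝ)‖) :
    ∃ v : Fin n → ℚ, commonDen v ≤ N (i + 1) ^ n ∧ ‖x - fun i => (v i : ℝ)‖ ≤ ρ i / M / 2 := by
  classical
  have hM0 : 0 < M := by linarith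
  rcases h.succ i with ⟨h1, -⟩ | ⟨hj, -⟩
  · exact absurd h1 hi
  obtain ⟨v, hv, hxv⟩ := exists_rat_norm_sub_le x hj.pos
  refine ⟨v, hv, hxv.trans ?_⟩
  set d : ℝ := (commonDen v : ℝ) with hd
  set Q : ℝ := (N (i + 1) : ℝ) with hQ
  set r := ρ i / M with hr
  have hρ : ρ i = M * r := by rw [hr]; field_simp
  have hr0 : 0 < r := div_pos (h.pos i) hM0
  have hd1 : 1 ≤ d := by rw [hd]; exact_mod_cast commonDen_pos v
  have hd0 : 0 < d := by linarith
  have hQ0 : 0 < Q := by rw [hQ]; exact_mod_cast hj.pos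
  have hAr : A ≤ Q ^ (n + 1) * r := hj.le_mul
  by_cases hc : d ^ (n + 1) * ρ i ^ n ≤ κ
  · have hex : ∃ m, d ^ (n + 1) * ρ m ^ n ≤ κ := ⟨i, hc⟩
    have hspec := Nat.find_spec hex
    have hmin := fun m => Nat.find_min hex (m := m)
    have hmi : Nat.find hex ≤ i := Nat.find_min' hex hc
    set m := Nat.find hex with hm
    have hle : ρ m / M ≤ 1 / (d * Q) := (hx m hmi v hspec).trans hxv
    rcases h.aux_le_or hM i m hmi with hσ | ⟨m', hmm, hm'⟩
    · exfalso
      have h1 := hj.large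
      rw [div_lt_iff₀ (h.aux_pos i)] at h1
      rw [div_le_div_iff₀ hM0 (by positivity)] at hle
      have h2 : Q * σ i ≤ ρ m * (d * Q) := by
        calc Q * σ i = 1 * Q * σ i := by ring
          _ ≤ d * Q * ρ m := by
            have := (h.aux_pos i).le
            gcongr
          _ = _ := by ring
      linarith
    · have h1 : κ < d ^ (n + 1) * ρ m' ^ n := not_le.mp (hmin m' (by omega))
      rw [hm', div_div, div_le_div_iff₀ (by positivity) (by positivity)] at hle
      have h2 : (d * Q * ρ m') ^ n ≤ (M * M) ^ n := by
        have := h.pos m'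
        refine pow_le_pow_left₀ (by positivity) ?_ n
        linarith
      have h3 : κ * Q ^ n ≤ d * M ^ (2 * n) := by
        calc κ * Q ^ n ≤ d ^ (n + 1) * ρ m' ^ n * Q ^ n := by gcongr
          _ = d * (d * Q * ρ m') ^ n := by rw [mul_pow, mul_pow]; ring
          _ ≤ d * (M * M) ^ n := by gcongr
          _ = _ := by rw [pow_mul]; ring
      rw [div_le_iff₀ hκ] at hA'
      have h4 : 2 * M ^ (2 * n) ≤ d * M ^ (2 * n) * (Q * r) := by
        calc 2 * M ^ (2 * n) ≤ A * κ := hA'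
          _ ≤ Q ^ (n + 1) * r * κ := by gcongr
          _ = κ * Q ^ n * (Q * r) := by ring
          _ ≤ _ := by gcongr
      have h5 : 2 ≤ d * (Q * r) := by
        have : 0 < M ^ (2 * n) := by positivity
        nlinarith
      rw [div_le_div_iff₀ (by positivity) (by norm_num)]
      linarith
  · rw [not_le, hρ] at hc
    rw [div_le_iff₀ hκ] at hA
    have h1 : 2 ^ (n + 1) * M ^ n ≤ (d * Q * r) ^ (n + 1) * M ^ n := by
      calc 2 ^ (n + 1) * M ^ n ≤ A * κ := hA
        _ ≤ Q ^ (n + 1) * r * (d ^ (n + 1) * (M * r) ^ n) := by gcongr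
        _ = _ := by rw [mul_pow, mul_pow, mul_pow]; ring
    have h2 : (2 : ℝ) ^ (n + 1) ≤ (d * Q * r) ^ (n + 1) :=
      le_of_mul_le_mul_right h1 (by positivity)
    have h3 : 2 ≤ d * Q * r := le_of_pow_le_pow_left₀ (by omega) (by positivity) h2
    rw [div_le_div_iff₀ (by positivity) (by norm_num)]
    linarith

theorem exists_relocated_center (h : IsCantorScale n ψ M κ A K P s ρ σ N) (hM : 1 < M)
    (hκ : 0 < κ) (hA : 2 ^ (n + 1) * M ^ n / κ ≤ A) (hA' : 2 * M ^ (2 * n) / κ ≤ A) (i : ℕ)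
    {x : Fin n → ℝ} (hx : x ∈ ⋂ m < i, approxCond n κ M ρ N m) :
    ∃ z : Fin n → ℝ, Metric.closedBall z (ρ i) ⊆ Metric.closedBall x (parentRadius M ρ i) ∧
      (N i ≠ 0 → ∃ v : Fin n → ℚ, commonDen v ≤ N i ^ n ∧ z = fun i => (v i : ℝ)) := by
  cases i with
  | zero => exact ⟨x, le_rfl, fun h0 => absurd h.index_zero h0⟩
  | succ i =>
    by_cases hi : N (i + 1) = 0
    · refine ⟨x, Metric.closedBall_subset_closedBall ?_, fun h0 => absurd hi h0⟩
      exact h.succ_le hM i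
    · obtain ⟨v, hv, hxv⟩ := h.exists_rat_near hM hκ hA hA' hi (x := x) fun m hm v hv => by
        simp only [Set.mem_iInter] at hx
        exact (hx m (by omega)).1 v hv
      refine ⟨fun i => (v i : ℝ), Metric.closedBall_subset_closedBall' ?_, fun _ => ⟨v, hv, rfl⟩⟩
      rcases h.succ i with ⟨h1, -⟩ | ⟨hj, h2, -⟩
      · exact absurd h1 hi
      · rw [dist_comm, dist_eq_norm, h2]
        have := hj.inner
        simp only [parentRadius]
        linarith

theorem exists_children {l : ℕ} (h : IsCantorScale n ψ (8 * l) κ A K P s ρ σ N) (hn : 1 ≤ n)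
    (hl : n ≤ l) (hκ : 0 < κ) (hκ' : κ * ((n + 1).factorial * 2 ^ n) < 1)
    (hA : 2 ^ (n + 1) * (8 * l : ℝ) ^ n / κ ≤ A) (hA' : 2 * (8 * l : ℝ) ^ (2 * n) / κ ≤ A)
    (i : ℕ) (x : Fin n → ℝ)
    (hx : Metric.closedBall x (parentRadius (8 * l) ρ i) ⊆ ⋂ m < i, approxCond n κ (8 * l) ρ N m) :
    ∃ g : Fin (l ^ n) → Fin n → ℝ,
      (∀ k, Metric.closedBall (g k) (parentRadius (8 * l) ρ (i + 1)) ⊆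
        Metric.closedBall x (parentRadius (8 * l) ρ i) ∩ approxCond n κ (8 * l) ρ N i) ∧
      ∀ k k', k ≠ k' → 4 * parentRadius (8 * l) ρ (i + 1) ≤ dist (g k) (g k') := by
  have hl1 : (1 : ℝ) ≤ l := by exact_mod_cast hn.trans hl
  have hM : (1 : ℝ) < 8 * l := by linarith
  have hρ := h.pos i
  have hr : 0 ≤ parentRadius (8 * l) ρ i := by
    cases i with
    | zero => exact (h.pos 0).le
    | succ i =>
      have := h.pos i
      simp only [parentRadius]
      positivity
  obtain ⟨z, hz, hzN⟩ := h.exists_relocated_center hM hκ hA hA' i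
    (hx (Metric.mem_closedBall_self hr))
  set T : ℝ := (κ / ρ i ^ n) ^ (1 / ((n : ℝ) + 1)) with hT
  have hT0 : 0 ≤ T := by positivity
  have hTn : T ^ (n + 1) = κ / ρ i ^ n := by
    rw [hT, ← Real.rpow_natCast, ← Real.rpow_mul (by positivity)]
    push_cast
    rw [one_div_mul_cancel (by positivity), Real.rpow_one]
  obtain ⟨w, b, hw, hwb⟩ := exists_hyperplane hn z (ρ := 2 * ρ i) (T := T) (by positivity) hT0 (by
    rw [hTn]
    refine lt_of_eq_of_lt ?_ hκ'
    rw [mul_pow]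
    field_simp)
  obtain ⟨g, hg1, hg2, hg3⟩ := exists_children_avoiding_hyperplane hn hl z hρ hw b
  refine ⟨g, fun k y hy => ⟨hz (hg1 k hy), fun v hv => ?_, fun h0 => ?_⟩, hg3⟩
  · by_cases hvz : ‖z - fun i => (v i : ℝ)‖ ≤ 2 * ρ i
    · refine hg2 k y hy _ (hwb v hvz ?_)
      refine le_of_pow_le_pow_left₀ (n := n + 1) (by omega) hT0 ?_
      rw [hTn, le_div_iff₀ (by positivity)]
      exact hv
    · have h1 : dist y z ≤ ρ i := hg1 k hy
      have h2 : ‖z - fun i => (v i : ℝ)‖ ≤ dist y z + ‖y - fun i => (v i : ℝ)‖ := by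
        rw [dist_comm, dist_eq_norm]
        refine le_trans (le_of_eq ?_) (norm_add_le _ _)
        congr 1
        abel
      have h3 : ρ i / (8 * l) ≤ ρ i := div_le_self hρ.le hM.le
      linarith
  · obtain ⟨v, hv, rfl⟩ := hzN h0
    refine ⟨v, hv, ?_⟩
    rw [← dist_eq_norm]
    exact hg1 k hy

theorem le_dimH_iInter_approxCond {l : ℕ} {s : ℝ≥0}
    (h : IsCantorScale n ψ (8 * l) κ A K ((l ^ n : ℕ) : ℝ) s ρ σ N) (hn : 1 ≤ n)
    (hl : n ≤ l) (hl2 : 2 ≤ l) (hs : 0 < s) (hκ : 0 < κ)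
    (hκ' : κ * ((n + 1).factorial * 2 ^ n) < 1)
    (hA : 2 ^ (n + 1) * (8 * l : ℝ) ^ n / κ ≤ A) (hA' : 2 * (8 * l : ℝ) ^ (2 * n) / κ ≤ A) :
    (s : ℝ≥0∞) ≤ dimH (⋂ i, approxCond n κ (8 * l) ρ N i) := by
  have hl0 : (0 : ℝ) < 8 * l := by
    have : (0 : ℝ) < l := by exact_mod_cast (by omega : 0 < l)
    positivity
  refine le_dimH_iInter_of_separated_children (P := l ^ n)
    (hl2.trans (Nat.le_self_pow (by omega) l))
    (parentRadius (8 * l) ρ) (fun i => ?_) _ 0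
    (fun i x hx => h.exists_children hn hl hκ hκ' hA hA' i x hx) hs (C := (8 * l : ℝ) ^ (s : ℝ))
    fun i => ?_
  · cases i with
    | zero => exact h.pos 0
    | succ i => exact div_pos (h.pos i) hl0
  · simp only [parentRadius]
    rw [← Real.mul_rpow hl0.le (div_pos (h.pos i) hl0).le, mul_div_cancel₀ _ hl0.ne']
    exact h.mass i

/-- Points of the Cantor set have no very good rational approximations. -/
theorem exists_mul_le_norm_sub (h : IsCantorScale n ψ M κ A K P s ρ σ N) (hn : 1 ≤ n)
    (hpos : ∀ s, 0 < ψ s) (hanti : Antitone ψ) (hM : 1 < M) (hκ : 0 < κ) (hK : 0 < K)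
    {C : ℝ} (hC : 0 < C) (hψ : ∀ q : ℕ, 1 ≤ q → (q : ℝ) ^ (n + 1) * ψ q ^ n ≤ C) :
    ∃ c > 0, ∀ x ∈ ⋂ i, approxCond n κ M ρ N i, ∀ v : Fin n → ℚ,
      c * ψ (commonDen v) ≤ ‖x - fun i => (v i : ℝ)‖ := by
  classical
  have hM0 : 0 < M := by linarith
  set c₁ : ℝ := (κ / C) ^ (1 / (n : ℝ)) with hc₁
  have hn0 : (0 : ℝ) < n := by exact_mod_cast hn
  have hc₁0 : 0 < c₁ := by positivity
  have hc₁n : c₁ ^ n = κ / C := by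
    rw [hc₁, ← Real.rpow_natCast, ← Real.rpow_mul (by positivity),
      one_div_mul_cancel hn0.ne', Real.rpow_one]
  have hp0 := hpos 0
  have hρ0 := h.pos 0
  refine ⟨min (ρ 0 / M / ψ 0) (min (c₁ / M / M) (1 / (2 * K * M))), by positivity,
    fun x hx v => ?_⟩
  have hpv := hpos (commonDen v)
  have hd1 : (1 : ℝ) ≤ commonDen v := by exact_mod_cast commonDen_pos v
  set d : ℝ := (commonDen v : ℝ) with hd
  have hex : ∃ m, d ^ (n + 1) * ρ m ^ n ≤ κ := by
    have h1 := ((h.tendsto_zero hM).pow n).const_mul (d ^ (n + 1))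
    rw [zero_pow (by omega), mul_zero] at h1
    exact (h1.eventually_le_const hκ).exists
  have hspec := Nat.find_spec hex
  have hmin := fun m => Nat.find_min hex (m := m)
  set m := Nat.find hex with hm
  have hlow : ρ m / M ≤ ‖x - fun i => (v i : ℝ)‖ := (Set.mem_iInter.mp hx m).1 v hspec
  refine le_trans ?_ hlow
  rcases Nat.eq_zero_or_pos m with h0 | h0
  · rw [h0]
    calc _ ≤ ρ 0 / M / ψ 0 * ψ 0 := by
          gcongr
          · exact min_le_left _ _
          · exact hanti (Nat.zero_le _)
      _ = _ := by field_simp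
  · obtain ⟨m', hm'⟩ : ∃ m', m = m' + 1 := ⟨m - 1, by omega⟩
    have hκm : κ < d ^ (n + 1) * ρ m' ^ n := not_le.mp (hmin m' (by omega))
    have hpm := h.pos m'
    rw [hm']
    rcases h.succ m' with ⟨-, h1, -⟩ | ⟨hj, h1, -⟩
    · rw [h1]
      have h2 : c₁ * ψ (commonDen v) ≤ ρ m' := by
        refine le_of_pow_le_pow_left₀ (n := n) (by omega) hpm.le ?_
        have h3 : c₁ ^ n * (d ^ (n + 1) * ψ (commonDen v) ^ n) ≤ κ := by
          rw [hc₁n, div_mul_eq_mul_div, div_le_iff₀ hC]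
          gcongr
          exact hψ _ (commonDen_pos v)
        have h4 : d ^ (n + 1) * (c₁ * ψ (commonDen v)) ^ n ≤ d ^ (n + 1) * ρ m' ^ n := by
          refine le_trans (le_of_eq ?_) (h3.trans hκm.le)
          rw [mul_pow]
          ring
        exact le_of_mul_le_mul_left h4 (by positivity)
      calc _ ≤ c₁ / M / M * ψ (commonDen v) := by
            gcongr
            exact (min_le_right _ _).trans (min_le_left _ _)
        _ = c₁ * ψ (commonDen v) / M / M := by ring
        _ ≤ _ := by gcongr
    · have h2 := hj.doubling (commonDen v) (by
        rw [mul_div_cancel₀ _ hM0.ne']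
        exact hκm)
      calc _ ≤ 1 / (2 * K * M) * ψ (commonDen v) := by
            gcongr
            exact (min_le_right _ _).trans (min_le_right _ _)
        _ ≤ 1 / (2 * K * M) * (K * ψ (N (m' + 1) ^ n)) := by gcongr
        _ = _ := by rw [h1]; field_simp

theorem iInter_approxCond_subset (h : IsCantorScale n ψ M κ A K P s ρ σ N) (hn : 1 ≤ n)
    (hpos : ∀ s, 0 < ψ s) (hanti : Antitone ψ) (hM : 1 < M) (hκ : 0 < κ) (hK : 0 < K)
    {C : ℝ} (hC : 0 < C) (hψ : ∀ q : ℕ, 1 ≤ q → (q : ℝ) ^ (n + 1) * ψ q ^ n ≤ C) :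
    ⋂ i, approxCond n κ M ρ N i ⊆
      Wapprox n ψ \ ⋂ c ∈ Set.Ioi (0 : ℝ), Wapprox n (fun q => c * ψ q) := by
  obtain ⟨c, hc, hlow⟩ := h.exists_mul_le_norm_sub hn hpos hanti hM hκ hK hC hψ
  intro x hx
  refine ⟨fun hfin => ?_, fun hall => ?_⟩
  · obtain ⟨δ, hδ, hδv⟩ : ∃ δ > 0, ∀ v ∈ {v : Fin n → ℚ |
        ‖x - fun i => (v i : ℝ)‖ < ψ (commonDen v)}, δ < ‖x - fun i => (v i : ℝ)‖ := by
      have h1 : ∀ᶠ δ : ℝ in nhdsWithin 0 (Set.Ioi 0), ∀ v ∈ {v : Fin n → ℚ |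
          ‖x - fun i => (v i : ℝ)‖ < ψ (commonDen v)}, δ < ‖x - fun i => (v i : ℝ)‖ := by
        refine (eventually_all_finite hfin).mpr fun v _ => ?_
        have h2 : 0 < ‖x - fun i => (v i : ℝ)‖ :=
          (mul_pos hc (hpos _)).trans_le (hlow x hx v)
        exact nhdsWithin_le_nhds (eventually_lt_nhds h2)
      obtain ⟨δ, hδ1, hδ2⟩ := (h1.and self_mem_nhdsWithin).exists
      exact ⟨δ, hδ2, hδ1⟩
    obtain ⟨i, hi⟩ := eventually_atTop.mp ((h.tendsto_zero hM).eventually_lt_const hδ)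
    obtain ⟨m, hmi, hm⟩ := h.frequently i
    obtain ⟨v, hv, hxv⟩ := (Set.mem_iInter.mp hx m).2 hm
    obtain ⟨m', rfl⟩ : ∃ m', m = m' + 1 := by
      refine ⟨m - 1, ?_⟩
      have : m ≠ 0 := fun h0 => hm (h0 ▸ h.index_zero)
      omega
    rcases h.succ m' with ⟨h1, -⟩ | ⟨-, h1, -⟩
    · exact hm h1
    · have h2 : ψ (N (m' + 1) ^ n) ≤ ψ (commonDen v) := hanti hv
      have h3 := hpos (N (m' + 1) ^ n)
      have h4 := hδv v (show ‖x - fun i => (v i : ℝ)‖ < ψ (commonDen v) by linarith)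
      have h5 := hi _ hmi
      linarith
  · simp only [Set.mem_iInter] at hall
    obtain ⟨v, hv⟩ := (hall c hc).nonempty
    exact absurd (hlow x hx v) (not_le.mpr hv)

end IsCantorScale

theorem exists_pow_mul_pow_le {n : ℕ} (hn : 1 ≤ n) {ψ : ℕ → ℝ} (hpos : ∀ s, 0 < ψ s)
    (hsmall : Tendsto (fun s : ℕ => (s : ℝ) ^ (((n : ℝ) + 1) / n) * ψ s) atTop (nhds 0)) :
    ∃ C > 0, ∀ q : ℕ, (q : ℝ) ^ (n + 1) * ψ q ^ n ≤ C := by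
  obtain ⟨C, hC⟩ := hsmall.bddAbove_range
  have hn0 : (0 : ℝ) < n := by exact_mod_cast hn
  refine ⟨|C| ^ n + 1, by positivity, fun q => ?_⟩
  have h1 : (q : ℝ) ^ (((n : ℝ) + 1) / n) * ψ q ≤ |C| := (hC ⟨q, rfl⟩).trans (le_abs_self C)
  have hq := hpos q
  have h2 := pow_le_pow_left₀ (by positivity) h1 n
  rw [mul_pow, ← Real.rpow_natCast, ← Real.rpow_mul (by positivity),
    div_mul_cancel₀ _ hn0.ne'] at h2
  have h3 : (q : ℝ) ^ ((n : ℝ) + 1) = (q : ℝ) ^ (n + 1) := by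
    rw [← Real.rpow_natCast]; push_cast; rfl
  rw [h3] at h2
  linarith

theorem exists_branching {n : ℕ} {s : ℝ} (hs : s < n) :
    ∃ l : ℕ, n ≤ l ∧ 2 ≤ l ∧ (8 * l : ℝ) ^ s ≤ ((l ^ n : ℕ) : ℝ) := by
  have h1 : ∀ᶠ l : ℕ in atTop, (8 : ℝ) ^ s ≤ (l : ℝ) ^ (n - s) :=
    ((tendsto_rpow_atTop (by linarith)).comp tendsto_natCast_atTop_atTop).eventually_ge_atTop _
  obtain ⟨l, hl, hl1⟩ := (h1.and (eventually_ge_atTop (max n 2))).exists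
  have hl2 : 2 ≤ l := (le_max_right _ _).trans hl1
  have hl0 : (0 : ℝ) < l := by exact_mod_cast (by omega : 0 < l)
  refine ⟨l, (le_max_left _ _).trans hl1, hl2, ?_⟩
  rw [Real.mul_rpow (by norm_num) hl0.le]
  calc (8 : ℝ) ^ s * (l : ℝ) ^ s ≤ (l : ℝ) ^ (n - s) * (l : ℝ) ^ s := by gcongr
    _ = _ := by
      rw [← Real.rpow_add hl0, sub_add_cancel, Real.rpow_natCast]
      push_cast
      rfl

theorem le_dimH_of_unbounded {n : ℕ} (hn : 1 ≤ n) {ψ : ℕ → ℝ} (hpos : ∀ s, 0 < ψ s)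
    (hanti : Antitone ψ)
    (hsmall : Tendsto (fun s : ℕ => (s : ℝ) ^ (((n : ℝ) + 1) / n) * ψ s) atTop (nhds 0))
    {τ : ℝ} (hτ : 0 < τ) (hunb : ∀ C : ℝ, ∃ q : ℕ, 1 ≤ q ∧ C * (q : ℝ) ^ (-τ) < ψ q)
    {s : ℝ≥0} (hs : 0 < s) (hsn : (s : ℝ) < n) (hsτ : s * τ < n + 1) :
    (s : ℝ≥0∞) ≤ dimH (Wapprox n ψ \ ⋂ c ∈ Set.Ioi (0 : ℝ), Wapprox n (fun q => c * ψ q)) := by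
  have hn0 : (0 : ℝ) < n := by exact_mod_cast hn
  have hs0 : (0 : ℝ) < s := by exact_mod_cast hs
  obtain ⟨s', hs', hs'n⟩ : ∃ s', max (s : ℝ) (τ * s * n / (n + 1)) < s' ∧ s' < n := by
    refine exists_between (max_lt hsn ?_)
    rw [div_lt_iff₀ (by positivity)]
    nlinarith
  obtain ⟨hss', hs'τ⟩ := max_lt_iff.mp hs'
  rw [div_lt_iff₀ (by positivity)] at hs'τ
  obtain ⟨l, hnl, hl2, hl⟩ := exists_branching hs'n
  have hl1 : (2 : ℝ) ≤ l := by exact_mod_cast hl2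
  have hM : (1 : ℝ) < 8 * l := by linarith
  obtain ⟨κ, hκ, hκ'⟩ : ∃ κ : ℝ, 0 < κ ∧ κ * ((n + 1).factorial * 2 ^ n) < 1 := by
    have : (0 : ℝ) < (n + 1).factorial * 2 ^ n := by positivity
    refine ⟨1 / (2 * ((n + 1).factorial * 2 ^ n)), by positivity, ?_⟩
    rw [div_mul_eq_mul_div, div_lt_one (by positivity)]
    linarith
  set A : ℝ := max (2 ^ (n + 1) * (8 * l : ℝ) ^ n / κ) (2 * (8 * l : ℝ) ^ (2 * n) / κ) with hA
  have hA0 : 0 < A := lt_max_of_lt_left (by positivity)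
  obtain ⟨b, hb⟩ := exists_nat_ge ((A * (8 * l : ℝ) ^ 2) ^ n / κ)
  obtain ⟨C, hC, hψ⟩ := exists_pow_mul_pow_le hn hpos hsmall
  obtain ⟨ρ, σ, N, h⟩ := exists_isCantorScale hpos hM (P := ((l ^ n : ℕ) : ℝ)) (κ := κ) (A := A)
    (K := (((max b 2 ^ n : ℕ) : ℝ)) ^ τ) (s := s) (by positivity)
    ((Real.rpow_le_rpow_of_exponent_le hM.le hss'.le).trans hl) fun i₀ ρ σ hρ =>
      exists_isJumpScale hn hpos hanti hsmall hτ hunb hM hκ hA0 hs0 (hs0.trans hss') hl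
        (by linarith) (le_max_right b 2) (hb.trans (by exact_mod_cast le_max_left b 2)) i₀ σ hρ
  have hK : 0 < (((max b 2 ^ n : ℕ) : ℝ)) ^ τ := by
    have : 0 < max b 2 := by omega
    positivity
  refine (h.le_dimH_iInter_approxCond hn hnl hl2 hs hκ hκ' (le_max_left _ _)
    (le_max_right _ _)).trans (dimH_mono ?_)
  exact h.iInter_approxCond_subset hn hpos hanti hM hκ hK hC fun q _ => hψ q

/-- Hausdorff dimension of `ψ`-badly approximable points:
`Bad(ψ) = W(ψ) \ ⋂_{c>0} W(cψ)` has the same Hausdorff dimension as `W(ψ)`. -/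
theorem bad_approx_dimension (n : ℕ) (hn : 1 ≤ n) (ψ : ℕ → ℝ)
    (hpos : ∀ s, 0 < ψ s) (hanti : Antitone ψ)
    (hsmall : Tendsto (fun s : ℕ => (s : ℝ) ^ (((n : ℝ) + 1) / n) * ψ s) atTop (nhds 0)) :
    dimH (Wapprox n ψ \ ⋂ c ∈ Set.Ioi (0 : ℝ), Wapprox n (fun q => c * ψ q))
      = dimH (Wapprox n ψ) := by
  refine le_antisymm (dimH_mono Set.sdiff_subset) (le_of_forall_lt fun t ht => ?_)
  obtain ⟨s, hts, hsW⟩ := ENNReal.lt_iff_exists_nnreal_btwn.mp ht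
  refine hts.trans_le ?_
  obtain ⟨s₁, hss₁, hs₁W⟩ := ENNReal.lt_iff_exists_nnreal_btwn.mp hsW
  have hs : 0 < s := ENNReal.coe_pos.mp (bot_le.trans_lt hts)
  have hss₁' : (s : ℝ) < s₁ := by exact_mod_cast hss₁
  have hs0 : (0 : ℝ) < s := by exact_mod_cast hs
  have hsn : (s : ℝ) < n := by
    have h1 : dimH (Wapprox n ψ) ≤ n :=
      (dimH_mono (Set.subset_univ _)).trans (Real.dimH_univ_pi_fin n).le
    exact_mod_cast hsW.trans_le h1
  obtain ⟨s₂, hss₂, hs₂s₁⟩ := exists_between hss₁'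
  have hs₂0 : 0 < s₂ := hs0.trans hss₂
  refine le_dimH_of_unbounded hn hpos hanti hsmall (τ := (n + 1) / s₂) (by positivity)
    (fun C => ?_) hs hsn ?_
  · by_contra! hC
    refine absurd (dimH_Wapprox_le hpos hanti hC (s := s₁) ?_ ?_) (not_le.mpr hs₁W)
    · exact_mod_cast hs0.trans hss₁'
    · rw [mul_div_assoc', lt_div_iff₀ hs₂0, mul_comm]
      gcongr
  · rw [mul_div_assoc', div_lt_iff₀ hs₂0, mul_comm]
    gcongr
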